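/- Let $\mathcal{S}$ be an inductive limit in the category of operator systems of commutative unital $C^*$-algebras $Z_n$ along unital completely positive maps $\Theta_{n+1,n} : Z_n \to Z_{n+1}$, with canonical UCP maps $\Theta_{\infty,n}: Z_n \to \mathcal{S}$ whose images exhaust $\mathcal{S}$. Then any unital positive linear map $\Psi : \mathcal{S} \to \mathcal{T}$ into an operator system $\mathcal{T}$ is automatically completely positive. -/

import Mathlib

open Matrix

/-- Conjugation of a `T`-valued matrix by a scalar matrix: `(Aᴴ X A)`. -/
noncomputable def conjMat {T : Type*} [AddCommGroup T] [Module ℂ T] {k l : ℕ}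
    (A : Matrix (Fin k) (Fin l) ℂ) (X : Matrix (Fin k) (Fin k) T) :
    Matrix (Fin l) (Fin l) T :=
  Matrix.of fun i j => ∑ s, ∑ t, ((starRingEnd ℂ) (A s i) * A t j) • X s t

/-- The diagonal matrix with constant entry `e` (the matrix order unit `e^{(k)}`). -/
noncomputable def diagE {T : Type*} [AddCommGroup T] [Module ℂ T] (e : T) (k : ℕ) :
    Matrix (Fin k) (Fin k) T :=
  Matrix.of fun i j => if i = j then e else 0

theorem aux_sqrt {K : Type*} [TopologicalSpace K] (f : C(K, ℂ)) (φ : K → ℝ)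
    (hφ : ∀ x, 0 ≤ φ x) (hf : ∀ x, f x = (φ x : ℂ)) : ∃ g : C(K, ℂ), star g * g = f := by
  refine ⟨⟨fun x => ((Real.sqrt (f x).re : ℝ) : ℂ), by fun_prop⟩, ?_⟩
  ext x
  have h : (f x).re = φ x := by rw [hf x]; simp
  simp only [ContinuousMap.mul_apply, ContinuousMap.star_apply, ContinuousMap.coe_mk, h]
  rw [hf x]
  simp only [RCLike.star_def, Complex.conj_ofReal]
  rw [← Complex.ofReal_mul, Real.mul_self_sqrt (hφ x)]

/-- vector used for polarization -/
noncomputable def polVec {k : ℕ} (i j : Fin k) (w : ℂ) : Fin k → ℂ :=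
  fun a => (if i = a then 1 else 0) + w * (if j = a then 1 else 0)

/-- fourth roots of unity -/
noncomputable def polW : Fin 4 → ℂ := ![1, -1, Complex.I, -Complex.I]

theorem pol_one {k : ℕ} (i j a b : Fin k) (η : ℝ) (r : ℂ) :
    ∑ q : Fin 4, (((η + ((starRingEnd ℂ) (polW q) * r).re : ℝ) : ℂ)) *
      ((starRingEnd ℂ) (polVec i j (polW q) a) * polVec i j (polW q) b)
    = 4 * (η : ℂ) * ((if i = a then 1 else 0) * (if i = b then 1 else 0))
      + 4 * (η : ℂ) * ((if j = a then 1 else 0) * (if j = b then 1 else 0))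
      + 2 * r * ((if i = a then 1 else 0) * (if j = b then 1 else 0))
      + 2 * (starRingEnd ℂ) r * ((if j = a then 1 else 0) * (if i = b then 1 else 0)) := by
  simp only [Fin.sum_univ_four, polW, polVec, Matrix.cons_val, map_add, map_mul, map_neg, map_one,
    Complex.conj_I, apply_ite (starRingEnd ℂ), map_zero]
  generalize (if i = a then (1:ℂ) else 0) = x1
  generalize (if j = a then (1:ℂ) else 0) = x2
  generalize (if i = b then (1:ℂ) else 0) = x3
  generalize (if j = b then (1:ℂ) else 0) = x4
  have hr : r = (r.re : ℂ) + r.im * Complex.I := (Complex.re_add_im r).symm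
  have hc : (starRingEnd ℂ) r = (r.re : ℂ) - r.im * Complex.I := by
    apply Complex.ext <;> simp
  rw [hc]
  have e1 : (1 * r).re = r.re := by simp
  have e2 : (-1 * r).re = -r.re := by simp
  have e3 : (-Complex.I * r).re = r.im := by simp
  have e4 : (- -Complex.I * r).re = -r.im := by simp
  rw [e1, e2, e3, e4]
  conv_rhs => rw [hr]
  simp only [Complex.add_re, Complex.add_im, Complex.ofReal_re, Complex.ofReal_im, Complex.mul_re,
    Complex.mul_im, Complex.I_re, Complex.I_im, mul_zero, mul_one, sub_zero, add_zero, zero_add]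
  push_cast
  have hI : Complex.I * Complex.I = -1 := Complex.I_mul_I
  linear_combination (-2 * (η : ℂ) * x2 * x4) * hI

theorem pol_all {k : ℕ} (a b : Fin k) (η : ℝ) (r : Matrix (Fin k) (Fin k) ℂ)
    (hr : ∀ i j, (starRingEnd ℂ) (r i j) = r j i) :
    ∑ i, ∑ j, ∑ q : Fin 4, (((η + ((starRingEnd ℂ) (polW q) * r i j).re : ℝ) : ℂ)) *
      ((starRingEnd ℂ) (polVec i j (polW q) a) * polVec i j (polW q) b)
    = 4 * (r a b + (2 * k * η : ℝ) * (if a = b then 1 else 0)) := by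
  simp only [pol_one, Finset.sum_add_distrib, hr]
  simp [Finset.sum_ite_eq, ← Finset.mul_sum]
  by_cases h : a = b
  · subst h; simp; ring
  · have h' : ¬ b = a := fun h' => h h'.symm
    simp [h, h']; ring

section
variable {K : Type*} [TopologicalSpace K] [CompactSpace K] [T2Space K]

/-- abstract cone properties -/
structure GoodCone (K : Type*) [TopologicalSpace K] (k : ℕ)
    (C : Set (Matrix (Fin k) (Fin k) C(K, ℂ))) : Prop where
  zero : 0 ∈ C
  add : ∀ X Y, X ∈ C → Y ∈ C → X + Y ∈ C
  smul : ∀ r : ℝ, 0 ≤ r → ∀ X ∈ C, (r : ℂ) • X ∈ C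
  one : 1 ∈ C
  rk : ∀ (f : C(K, ℂ)) (v : Fin k → ℂ),
    (Matrix.of fun i j => ((starRingEnd ℂ) (v i) * v j) • (star f * f)) ∈ C

theorem GoodCone.sum {k : ℕ} {C : Set (Matrix (Fin k) (Fin k) C(K, ℂ))} (h : GoodCone K k C)
    {ι : Type*} (s : Finset ι) (F : ι → Matrix (Fin k) (Fin k) C(K, ℂ)) (hF : ∀ i ∈ s, F i ∈ C) :
    ∑ i ∈ s, F i ∈ C :=
  Finset.sum_induction F (· ∈ C) h.add h.zero hF

theorem GoodCone.rk' {k : ℕ} {C : Set (Matrix (Fin k) (Fin k) C(K, ℂ))} (h : GoodCone K k C)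
    (f : C(K, ℂ)) (φ : K → ℝ) (hφ : ∀ x, 0 ≤ φ x) (hf : ∀ x, f x = (φ x : ℂ)) (v : Fin k → ℂ) :
    (Matrix.of fun i j => ((starRingEnd ℂ) (v i) * v j) • f) ∈ C := by
  obtain ⟨g, rfl⟩ := aux_sqrt f φ hφ hf
  exact h.rk g v

theorem GoodCone.small {k : ℕ} {C : Set (Matrix (Fin k) (Fin k) C(K, ℂ))} (h : GoodCone K k C)
    (R : Matrix (Fin k) (Fin k) C(K, ℂ)) (hR : ∀ i j x, (starRingEnd ℂ) (R i j x) = R j i x)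
    (η : ℝ) (hη : ∀ i j x, ‖R i j x‖ ≤ η) :
    R + ((2 * k * η : ℝ) : ℂ) • (1 : Matrix (Fin k) (Fin k) C(K, ℂ)) ∈ C := by
  let f : Fin k → Fin k → Fin 4 → C(K, ℂ) := fun i j q =>
    ⟨fun x => (((η + ((starRingEnd ℂ) (polW q) * R i j x).re : ℝ) : ℂ)), by fun_prop⟩
  have key : R + ((2 * k * η : ℝ) : ℂ) • (1 : Matrix (Fin k) (Fin k) C(K, ℂ)) =
      ((1 / 4 : ℝ) : ℂ) • ∑ i, ∑ j, ∑ q : Fin 4, (Matrix.of fun a b =>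
        ((starRingEnd ℂ) (polVec i j (polW q) a) * polVec i j (polW q) b) • f i j q) := by
    ext a b x
    have := pol_all a b η (fun i j => R i j x) (fun i j => hR i j x)
    simp only [Matrix.add_apply, Matrix.smul_apply, Matrix.sum_apply, Matrix.of_apply,
      ContinuousMap.add_apply, ContinuousMap.smul_apply, ContinuousMap.sum_apply, smul_eq_mul]
    have e : ∀ i j q, f i j q x = (((η + ((starRingEnd ℂ) (polW q) * R i j x).re : ℝ) : ℂ)) :=
      fun i j q => rfl
    have e1 : (1 : Matrix (Fin k) (Fin k) C(K, ℂ)) a b x = if a = b then 1 else 0 := by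
      rw [Matrix.one_apply]; split_ifs <;> simp
    simp only [e, e1]
    simp only [mul_comm _ ((((η + _ : ℝ) : ℂ)))]
    rw [this]
    push_cast
    ring
  rw [key]
  refine h.smul _ (by norm_num) _ (h.sum _ _ fun i _ => h.sum _ _ fun j _ => h.sum _ _ fun q _ => ?_)
  refine h.rk' (f i j q) (fun x => η + ((starRingEnd ℂ) (polW q) * R i j x).re) (fun x => ?_)
    (fun x => rfl) _
  have h1 : |((starRingEnd ℂ) (polW q) * R i j x).re| ≤ ‖(starRingEnd ℂ) (polW q) * R i j x‖ :=
    Complex.abs_re_le_norm _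
  have h2 : ‖polW q‖ = 1 := by fin_cases q <;> simp [polW]
  rw [norm_mul, RCLike.norm_conj, h2, one_mul] at h1
  have := (abs_le.1 (h1.trans (hη i j x))).1
  linarith

theorem GoodCone.main {k : ℕ} {C : Set (Matrix (Fin k) (Fin k) C(K, ℂ))} (h : GoodCone K k C)
    (B : Matrix (Fin k) (Fin k) C(K, ℂ)) (δ : ℝ) (hδ : 0 < δ) :
    Bᴴ * B + (δ : ℂ) • (1 : Matrix (Fin k) (Fin k) C(K, ℂ)) ∈ C := by
  set G := Bᴴ * B with hG
  have hGx : ∀ i j x, G i j x = ∑ l, (starRingEnd ℂ) (B l i x) * B l j x := by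
    intro i j x
    simp [hG, Matrix.mul_apply, ContinuousMap.sum_apply]
  have hGh : ∀ i j x, (starRingEnd ℂ) (G i j x) = G j i x := by
    intro i j x
    simp only [hGx, map_sum, map_mul, Complex.conj_conj]
    exact Finset.sum_congr rfl fun l _ => mul_comm _ _
  let η : ℝ := δ / (2 * (k + 1))
  have hη : 0 < η := by positivity
  let U : K → Set K := fun p => {y | ∀ i j, ‖G i j y - G i j p‖ < η}
  have hUo : ∀ p, IsOpen (U p) := by
    intro p
    simp only [U, Set.setOf_forall]
    exact isOpen_iInter_of_finite fun i => isOpen_iInter_of_finite fun j =>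
      isOpen_lt (by fun_prop) continuous_const
  obtain ⟨t, ht⟩ := isCompact_univ.elim_finite_subcover U hUo
    (fun p _ => Set.mem_iUnion.2 ⟨p, by intro i j; simpa using hη⟩)
  obtain ⟨ρ, hρ⟩ := PartitionOfUnity.exists_isSubordinate isClosed_univ
    (fun p : t => U p) (fun p => hUo p) (by
      intro x hx
      have := ht hx
      simp only [Set.mem_iUnion] at this ⊢
      obtain ⟨p, hp, hpx⟩ := this
      exact ⟨⟨p, hp⟩, hpx⟩)
  have hsum : ∀ x, ∑ p : t, ρ p x = 1 := by
    intro x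
    rw [← finsum_eq_sum_of_fintype]
    exact ρ.sum_eq_one (Set.mem_univ x)
  let f : t → C(K, ℂ) := fun p => ⟨fun x => ((ρ p x : ℝ) : ℂ), by fun_prop⟩
  have hf : ∀ p x, f p x = ((ρ p x : ℝ) : ℂ) := fun p x => rfl
  let M : Matrix (Fin k) (Fin k) C(K, ℂ) := ∑ p : t, ∑ l, (Matrix.of fun a b =>
        ((starRingEnd ℂ) (B l a p) * B l b p) • f p)
  have hM : M ∈ C := h.sum _ _ fun p _ => h.sum _ _ fun l _ =>
    h.rk' (f p) (fun x => ρ p x) (fun x => ρ.nonneg p x) (fun x => rfl) (fun a => B l a p)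
  have hMx : ∀ i j x, M i j x = ∑ p : t, (ρ p x : ℂ) * G i j p := by
    intro i j x
    simp only [M, Matrix.sum_apply, ContinuousMap.sum_apply, Matrix.of_apply,
      ContinuousMap.smul_apply, smul_eq_mul, hf, hGx, Finset.mul_sum]
    exact Finset.sum_congr rfl fun p _ => Finset.sum_congr rfl fun l _ => mul_comm _ _
  have hR := h.small (G - M) (by
      intro i j x
      simp only [Matrix.sub_apply, ContinuousMap.sub_apply, map_sub, hGh, hMx, map_sum, map_mul,
        Complex.conj_ofReal]) η (by
      intro i j x
      have e : (G - M) i j x = ∑ p : t, (ρ p x : ℂ) * (G i j x - G i j p) := by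
        simp only [Matrix.sub_apply, ContinuousMap.sub_apply, hMx, mul_sub, Finset.sum_sub_distrib,
          ← Finset.sum_mul]
        rw [← Complex.ofReal_sum, hsum]; simp
      rw [e]
      calc _ ≤ ∑ p : t, ‖(ρ p x : ℂ) * (G i j x - G i j p)‖ := norm_sum_le _ _
        _ ≤ ∑ p : t, ρ p x * η := by
            refine Finset.sum_le_sum fun p _ => ?_
            rw [norm_mul, Complex.norm_real, Real.norm_of_nonneg (ρ.nonneg p x)]
            by_cases hx : ρ p x = 0
            · simp [hx]
            · have : x ∈ U p := hρ p (subset_tsupport _ hx)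
              exact mul_le_mul_of_nonneg_left (this i j).le (ρ.nonneg p x)
        _ = η := by rw [← Finset.sum_mul, hsum, one_mul])
  have hd : 0 ≤ δ - 2 * k * η := by
    have : δ = 2 * (k + 1) * η := by simp only [η]; field_simp
    rw [this]; nlinarith
  have := h.add _ _ (h.add _ _ hM hR) (h.smul _ hd _ h.one)
  convert this using 1
  rw [add_assoc, add_assoc, ← add_smul, ← add_assoc]
  congr 1
  · abel
  · congr 1; push_cast; ring

end

theorem cp_on_CK {K : Type*} [TopologicalSpace K] [CompactSpace K] [T2Space K]
    (T : Type*) [AddCommGroup T] [Module ℂ T] (eT : T)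
    (PT : ∀ k : ℕ, Set (Matrix (Fin k) (Fin k) T))
    (hPTadd : ∀ (k : ℕ) (X Y : Matrix (Fin k) (Fin k) T),
      X ∈ PT k → Y ∈ PT k → X + Y ∈ PT k)
    (hPTsmul : ∀ (k : ℕ) (r : ℝ), 0 ≤ r → ∀ X ∈ PT k, (r : ℂ) • X ∈ PT k)
    (hPTconj : ∀ (k l : ℕ) (A : Matrix (Fin k) (Fin l) ℂ) (X : Matrix (Fin k) (Fin k) T),
      X ∈ PT k → conjMat A X ∈ PT l)
    (hPTe : ∀ k, diagE eT k ∈ PT k)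
    (hPTarch : ∀ (k : ℕ) (X : Matrix (Fin k) (Fin k) T),
      (∀ ε : ℝ, 0 < ε → X + (ε : ℂ) • diagE eT k ∈ PT k) → X ∈ PT k)
    (Φ : C(K, ℂ) →ₗ[ℂ] T) (h1 : Φ 1 = eT)
    (hpos : ∀ f : C(K, ℂ), (Matrix.of fun _ _ : Fin 1 => Φ (star f * f)) ∈ PT 1)
    (k : ℕ) (B : Matrix (Fin k) (Fin k) C(K, ℂ)) : (Bᴴ * B).map Φ ∈ PT k := by
  have hone : (1 : Matrix (Fin k) (Fin k) C(K, ℂ)).map Φ = diagE eT k := by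
    ext i j
    simp only [Matrix.map_apply, Matrix.one_apply, diagE, Matrix.of_apply]
    split_ifs <;> simp [h1]
  have hadd : ∀ X Y : Matrix (Fin k) (Fin k) C(K, ℂ), (X + Y).map Φ = X.map Φ + Y.map Φ := by
    intro X Y; ext i j; simp
  have hsmul : ∀ (c : ℂ) (X : Matrix (Fin k) (Fin k) C(K, ℂ)), (c • X).map Φ = c • X.map Φ := by
    intro c X; ext i j; simp
  have hC : GoodCone K k {M | M.map Φ ∈ PT k} := by
    refine ⟨?_, ?_, ?_, ?_, ?_⟩
    · have := hPTsmul k 0 le_rfl _ (hPTe k)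
      simp only [Set.mem_setOf_eq]
      convert this using 1
      ext i j; simp
    · intro X Y hX hY
      simp only [Set.mem_setOf_eq, hadd]
      exact hPTadd _ _ _ hX hY
    · intro r hr X hX
      simp only [Set.mem_setOf_eq, hsmul]
      exact hPTsmul _ _ hr _ hX
    · simp only [Set.mem_setOf_eq, hone]
      exact hPTe k
    · intro f v
      have := hPTconj 1 k (Matrix.of fun _ j => v j) _ (hpos f)
      simp only [Set.mem_setOf_eq]
      convert this using 1
      ext i j
      simp [conjMat]
  refine hPTarch k _ fun ε hε => ?_
  have := hC.main B ε hε
  simpa only [Set.mem_setOf_eq, hadd, hsmul, hone] using this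

/-- let `S` be the inductive limit, in the category of operator systems,
of commutative (unital) C*-algebras `Zₙ` along UCP maps `Θₙ`, with canonical UCP maps
`θₙ : Zₙ → S` of exhausting images and the Archimedeanized matrix cones `PS`.  Then
any unital positive linear map `Ψ : S → T` into an operator system `T` (matrix ordered
space with Archimedean matrix order unit) is automatically completely positive. -/
theorem unital_positive_on_inductive_limit_is_cp
    -- commutative C*-algebras Zₙ
    (Z : ℕ → Type*) [∀ n, NormedCommRing (Z n)] [∀ n, StarRing (Z n)]
    [∀ n, CStarRing (Z n)] [∀ n, NormedAlgebra ℂ (Z n)] [∀ n, StarModule ℂ (Z n)]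
    [∀ n, CompleteSpace (Z n)]
    -- UCP connecting maps
    (Θ : ∀ n, Z n →ₗ[ℂ] Z (n + 1))
    (hΘ1 : ∀ n, Θ n 1 = 1)
    (hΘcp : ∀ (n : ℕ) (k : ℕ) (B : Matrix (Fin k) (Fin k) (Z n)),
      ∃ C : Matrix (Fin k) (Fin k) (Z (n + 1)),
        (Bᴴ * B).map (Θ n) = Cᴴ * C)
    -- the inductive limit operator system S
    (S : Type*) [AddCommGroup S] [Module ℂ S] (e : S)
    (θ : ∀ n, Z n →ₗ[ℂ] S)
    (hθcompat : ∀ (n : ℕ) (f : Z n), θ (n + 1) (Θ n f) = θ n f)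
    (hθ1 : ∀ n, θ n 1 = e)
    (hθsurj : ∀ s : S, ∃ (n : ℕ) (f : Z n), θ n f = s)
    (PS : ∀ k : ℕ, Set (Matrix (Fin k) (Fin k) S))
    -- the Archimedeanized inductive-limit matrix cones of S
    (hPS : ∀ (k : ℕ) (X : Matrix (Fin k) (Fin k) S),
      X ∈ PS k ↔ ∀ ε : ℝ, 0 < ε →
        ∃ (n : ℕ) (B : Matrix (Fin k) (Fin k) (Z n)),
          (Bᴴ * B).map (θ n) = X + (ε : ℂ) • diagE e k)
    -- the target operator system T
    (T : Type*) [AddCommGroup T] [Module ℂ T] (eT : T)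
    (PT : ∀ k : ℕ, Set (Matrix (Fin k) (Fin k) T))
    (hPTadd : ∀ (k : ℕ) (X Y : Matrix (Fin k) (Fin k) T),
      X ∈ PT k → Y ∈ PT k → X + Y ∈ PT k)
    (hPTsmul : ∀ (k : ℕ) (r : ℝ), 0 ≤ r → ∀ X ∈ PT k, (r : ℂ) • X ∈ PT k)
    (hPTconj : ∀ (k l : ℕ) (A : Matrix (Fin k) (Fin l) ℂ) (X : Matrix (Fin k) (Fin k) T),
      X ∈ PT k → conjMat A X ∈ PT l)
    (hPTe : ∀ k, diagE eT k ∈ PT k)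
    (hPTarch : ∀ (k : ℕ) (X : Matrix (Fin k) (Fin k) T),
      (∀ ε : ℝ, 0 < ε → X + (ε : ℂ) • diagE eT k ∈ PT k) → X ∈ PT k)
    -- a unital positive map Ψ : S → T
    (Ψ : S →ₗ[ℂ] T)
    (hΨ1 : Ψ e = eT)
    (hΨpos : ∀ X ∈ PS 1, X.map Ψ ∈ PT 1) :
    -- conclusion: Ψ is completely positive
    ∀ k : ℕ, ∀ X ∈ PS k, X.map Ψ ∈ PT k := by
  intro k X hX
  refine hPTarch k _ fun ε hε => ?_
  obtain ⟨n, B, hB⟩ := (hPS k X).1 hX ε hε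
  letI : CommCStarAlgebra (Z n) := {}
  let γ := gelfandStarTransform (Z n)
  let Φ : C(WeakDual.characterSpace ℂ (Z n), ℂ) →ₗ[ℂ] T :=
    Ψ ∘ₗ (θ n) ∘ₗ (γ.symm : C(WeakDual.characterSpace ℂ (Z n), ℂ) →ₗ[ℂ] Z n)
  have hΦ : ∀ f, Φ f = Ψ (θ n (γ.symm f)) := fun f => rfl
  have key := cp_on_CK T eT PT hPTadd hPTsmul hPTconj hPTe hPTarch Φ
    (by rw [hΦ, map_one, hθ1, hΨ1]) (by
      intro f
      have hm : (Matrix.of fun _ _ : Fin 1 => θ n (γ.symm (star f * f))) ∈ PS 1 := by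
        rw [hPS]
        intro δ hδ
        obtain ⟨g, hg⟩ := aux_sqrt (star f * f + (δ : ℂ) • 1) (fun x => ‖f x‖ ^ 2 + δ)
          (fun x => by positivity) (by
            intro x
            simp [← Complex.normSq_eq_conj_mul_self, Complex.normSq_eq_norm_sq])
        refine ⟨n, Matrix.of fun _ _ => γ.symm g, ?_⟩
        ext i j
        have hij : i = j := Subsingleton.elim _ _
        have : star (γ.symm g) * γ.symm g = γ.symm (star f * f) + (δ : ℂ) • 1 := by
          rw [← map_star, ← map_mul, hg, map_add, map_smul, map_one]
        simp [Matrix.mul_apply, diagE, hij, this, hθ1, -map_mul]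
      have := hΨpos _ hm
      convert this using 1
      ext i j
      rfl)
    k (B.map γ)
  convert key using 1
  have e1 : X.map Ψ + (ε : ℂ) • diagE eT k = (X + (ε : ℂ) • diagE e k).map Ψ := by
    ext i j
    simp only [diagE, Matrix.map_apply, Matrix.add_apply, Matrix.smul_apply, Matrix.of_apply,
      map_add, map_smul]
    split_ifs <;> simp [hΨ1]
  rw [e1, ← hB]
  ext i j
  simp only [Matrix.map_apply, hΦ, Matrix.mul_apply, Matrix.conjTranspose_apply]
  congr 2
  rw [map_sum]
  refine Finset.sum_congr rfl fun l _ => ?_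
  rw [← map_star, ← map_mul, StarAlgEquiv.symm_apply_apply]
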